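/- Let ρ be an idempotent-separating congruence on an inverse semigroup S with kernel K. Then the relations ρ and ≃_K are equal: for all s, t ∈ S, s ρ t if and only if s ≃_K t. -/

import Mathlib

/-- An inverse semigroup: a semigroup in which every element `s` has a
(unique) inverse `s⁻¹` with `s * s⁻¹ * s = s` and `s⁻¹ * s * s⁻¹ = s⁻¹`. -/
class InverseSemigroup (S : Type*) extends Semigroup S, Inv S where
  mul_inv_mul : ∀ s : S, s * s⁻¹ * s = s
  inv_mul_inv : ∀ s : S, s⁻¹ * s * s⁻¹ = s⁻¹
  inv_unique : ∀ s t : S, s * t * s = s → t * s * t = t → t = s⁻¹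

/-- The natural partial order on an inverse semigroup:
`s ≤ t` iff `s = e * t` for some idempotent `e`. -/
def NatLe {S : Type*} [InverseSemigroup S] (s t : S) : Prop :=
  ∃ e : S, IsIdempotentElem e ∧ s = e * t

/-- A normal inverse subsemigroup: a full inverse subsemigroup that is
closed under conjugation. -/
structure IsNormalInverseSubsemigroup {S : Type*} [InverseSemigroup S] (N : Set S) : Prop where
  mul_mem : ∀ {a b : S}, a ∈ N → b ∈ N → a * b ∈ N
  inv_mem : ∀ {a : S}, a ∈ N → a⁻¹ ∈ N
  full : ∀ {e : S}, IsIdempotentElem e → e ∈ N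
  conj_mem : ∀ (s : S) {n : S}, n ∈ N → s⁻¹ * n * s ∈ N

/-- The preorder `≤_N` associated to a normal inverse subsemigroup `N`:
`s ≤_N t` iff there are `a, b ∈ N` with `a⁻¹ * a = s * s⁻¹`,
`s⁻¹ * s = b * b⁻¹` (so `a · s · b` is a trace product) and `a * s * b ≤ t`. -/
def LeN {S : Type*} [InverseSemigroup S] (N : Set S) (s t : S) : Prop :=
  ∃ a ∈ N, ∃ b ∈ N, a⁻¹ * a = s * s⁻¹ ∧ s⁻¹ * s = b * b⁻¹ ∧ NatLe (a * s * b) t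

/-- The equivalence `≃_N` obtained by symmetrizing `≤_N`. -/
def SimeqN {S : Type*} [InverseSemigroup S] (N : Set S) (s t : S) : Prop :=
  LeN N s t ∧ LeN N t s

/-- A congruence on a semigroup: an equivalence relation compatible with
multiplication. -/
structure IsCongruence {S : Type*} [InverseSemigroup S] (ρ : S → S → Prop) : Prop where
  refl : ∀ s : S, ρ s s
  symm : ∀ {s t : S}, ρ s t → ρ t s
  trans : ∀ {s t u : S}, ρ s t → ρ t u → ρ s u
  mul_compat : ∀ {a b c d : S}, ρ a b → ρ c d → ρ (a * c) (b * d)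

namespace InverseSemigroup

variable {S : Type*} [InverseSemigroup S]

theorem inv_eq_self {e : S} (he : IsIdempotentElem e) : e⁻¹ = e :=
  (inv_unique e e (by rw [he.eq, he.eq]) (by rw [he.eq, he.eq])).symm

theorem inv_inv_eq (s : S) : s⁻¹⁻¹ = s :=
  (inv_unique s⁻¹ s (inv_mul_inv s) (mul_inv_mul s)).symm

theorem isIdempotentElem_mul_inv (s : S) : IsIdempotentElem (s * s⁻¹) := by
  rw [IsIdempotentElem, ← mul_assoc, mul_inv_mul]

theorem isIdempotentElem_inv_mul (s : S) : IsIdempotentElem (s⁻¹ * s) := by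
  rw [IsIdempotentElem, ← mul_assoc, inv_mul_inv]

theorem isIdempotentElem_mul {e f : S} (he : IsIdempotentElem e) (hf : IsIdempotentElem f) :
    IsIdempotentElem (e * f) := by
  have h1 := mul_inv_mul (e * f)
  have h2 := inv_mul_inv (e * f)
  have hx : f * (e * f)⁻¹ * e = (e * f)⁻¹ := by
    apply inv_unique
    · calc e * f * (f * (e * f)⁻¹ * e) * (e * f)
          = e * (f * f) * (e * f)⁻¹ * ((e * e) * f) := by simp only [mul_assoc]
        _ = e * f := by rw [he.eq, hf.eq, h1]
    · calc f * (e * f)⁻¹ * e * (e * f) * (f * (e * f)⁻¹ * e)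
          = f * ((e * f)⁻¹ * ((e * e) * (f * f)) * (e * f)⁻¹) * e := by simp only [mul_assoc]
        _ = f * (e * f)⁻¹ * e := by rw [he.eq, hf.eq, h2]
  have hxx : IsIdempotentElem (e * f)⁻¹ := by
    calc (e * f)⁻¹ * (e * f)⁻¹
        = f * (e * f)⁻¹ * e * (f * (e * f)⁻¹ * e) := by rw [hx]
      _ = f * ((e * f)⁻¹ * (e * f) * (e * f)⁻¹) * e := by simp only [mul_assoc]
      _ = (e * f)⁻¹ := by rw [h2, hx]
  rwa [← inv_eq_self hxx, inv_inv_eq] at hxx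

theorem mul_comm_of_isIdempotentElem {e f : S} (he : IsIdempotentElem e)
    (hf : IsIdempotentElem f) : e * f = f * e := by
  have key : ∀ {a b : S}, IsIdempotentElem a → IsIdempotentElem b →
      a * b * (b * a) * (a * b) = a * b := fun {a b} ha hb => by
    calc a * b * (b * a) * (a * b) = a * (b * b) * ((a * a) * b) := by simp only [mul_assoc]
      _ = a * b := by rw [ha.eq, hb.eq, (isIdempotentElem_mul ha hb).eq]
  rw [inv_unique (e * f) (f * e) (key he hf) (key hf he),
    inv_eq_self (isIdempotentElem_mul he hf)]

theorem mul_inv_eq (s t : S) : (s * t)⁻¹ = t⁻¹ * s⁻¹ := by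
  have hc := mul_comm_of_isIdempotentElem (isIdempotentElem_mul_inv t)
    (isIdempotentElem_inv_mul s)
  symm
  apply inv_unique
  · calc s * t * (t⁻¹ * s⁻¹) * (s * t) = s * ((t * t⁻¹) * (s⁻¹ * s)) * t := by
          simp only [mul_assoc]
      _ = (s * s⁻¹ * s) * (t * t⁻¹ * t) := by rw [hc]; simp only [mul_assoc]
      _ = s * t := by rw [mul_inv_mul, mul_inv_mul]
  · calc t⁻¹ * s⁻¹ * (s * t) * (t⁻¹ * s⁻¹) = t⁻¹ * ((s⁻¹ * s) * (t * t⁻¹)) * s⁻¹ := by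
          simp only [mul_assoc]
      _ = (t⁻¹ * t * t⁻¹) * (s⁻¹ * s * s⁻¹) := by rw [← hc]; simp only [mul_assoc]
      _ = t⁻¹ * s⁻¹ := by rw [inv_mul_inv, inv_mul_inv]

end InverseSemigroup

namespace IsCongruence

open InverseSemigroup

variable {S : Type*} [InverseSemigroup S] {ρ : S → S → Prop}

theorem mul_left (hρ : IsCongruence ρ) {a b : S} (c : S) (h : ρ a b) : ρ (c * a) (c * b) :=
  hρ.mul_compat (hρ.refl c) h

theorem mul_right (hρ : IsCongruence ρ) {a b : S} (c : S) (h : ρ a b) : ρ (a * c) (b * c) :=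
  hρ.mul_compat h (hρ.refl c)

theorem inv_rel_inv (hρ : IsCongruence ρ) {a b : S} (h : ρ a b) : ρ a⁻¹ b⁻¹ := by
  have hab : ρ a⁻¹ (a⁻¹ * b * b⁻¹) := by
    have h1 : ρ (a⁻¹ * a * a⁻¹) (a⁻¹ * b * a⁻¹) := hρ.mul_right _ (hρ.mul_left _ h)
    have h2 : ρ (a⁻¹ * (b * b⁻¹) * a * a⁻¹) (a⁻¹ * (b * b⁻¹) * b * a⁻¹) :=
      hρ.mul_right _ (hρ.mul_left _ h)
    rw [inv_mul_inv] at h1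
    rw [mul_assoc a⁻¹ (b * b⁻¹) b, mul_inv_mul, mul_assoc _ a, mul_assoc a⁻¹ (b * b⁻¹),
      mul_comm_of_isIdempotentElem (isIdempotentElem_mul_inv b) (isIdempotentElem_mul_inv a),
      ← mul_assoc a⁻¹, ← mul_assoc a⁻¹ a, inv_mul_inv, ← mul_assoc] at h2
    exact hρ.trans h1 (hρ.symm h2)
  have hba : ρ b⁻¹ (a⁻¹ * a * b⁻¹) := by
    have h1 : ρ (b⁻¹ * b * b⁻¹) (b⁻¹ * a * b⁻¹) :=
      hρ.mul_right _ (hρ.mul_left _ (hρ.symm h))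
    have h2 : ρ (b⁻¹ * a * (a⁻¹ * a * b⁻¹)) (b⁻¹ * b * (a⁻¹ * a * b⁻¹)) :=
      hρ.mul_right _ (hρ.mul_left _ h)
    rw [inv_mul_inv] at h1
    rw [← mul_assoc (b⁻¹ * b) (a⁻¹ * a),
      mul_comm_of_isIdempotentElem (isIdempotentElem_inv_mul b) (isIdempotentElem_inv_mul a),
      mul_assoc (a⁻¹ * a) (b⁻¹ * b), inv_mul_inv, mul_assoc b⁻¹ a, ← mul_assoc a (a⁻¹ * a),
      ← mul_assoc a a⁻¹ a, mul_inv_mul, ← mul_assoc b⁻¹ a] at h2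
    exact hρ.trans h1 h2
  exact hρ.trans hab (hρ.symm (hρ.trans hba (hρ.mul_right _ (hρ.mul_left _ h))))

theorem leN_kernel_of_rel (hρ : IsCongruence ρ)
    (hsep : ∀ e f : S, IsIdempotentElem e → IsIdempotentElem f → ρ e f → e = f)
    {s t : S} (h : ρ s t) : LeN {u : S | ∃ e : S, IsIdempotentElem e ∧ ρ u e} s t := by
  have hl : s * s⁻¹ = t * t⁻¹ := hsep _ _ (isIdempotentElem_mul_inv s)
    (isIdempotentElem_mul_inv t) (hρ.mul_compat h (hρ.inv_rel_inv h))
  have hr : s⁻¹ * s = t⁻¹ * t := hsep _ _ (isIdempotentElem_inv_mul s)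
    (isIdempotentElem_inv_mul t) (hρ.mul_compat (hρ.inv_rel_inv h) h)
  have hs := isIdempotentElem_inv_mul s
  refine ⟨t * s⁻¹, ⟨s * s⁻¹, isIdempotentElem_mul_inv s, hρ.mul_right _ (hρ.symm h)⟩,
    s⁻¹ * s, ⟨s⁻¹ * s, hs, hρ.refl _⟩, ?_, ?_, t * t⁻¹, isIdempotentElem_mul_inv t, ?_⟩
  · calc (t * s⁻¹)⁻¹ * (t * s⁻¹) = s * (t⁻¹ * t) * s⁻¹ := by
          rw [mul_inv_eq, inv_inv_eq]; simp only [mul_assoc]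
      _ = s * s⁻¹ := by rw [← hr, ← mul_assoc, mul_inv_mul]
  · rw [inv_eq_self hs, hs.eq]
  · rw [mul_inv_mul, mul_assoc t, mul_assoc t, hs.eq, hr, ← mul_assoc, mul_inv_mul]

theorem exists_rel_mul_of_leN_kernel (hρ : IsCongruence ρ)
    (hsep : ∀ e f : S, IsIdempotentElem e → IsIdempotentElem f → ρ e f → e = f)
    {s t : S} (h : LeN {u : S | ∃ e : S, IsIdempotentElem e ∧ ρ u e} s t) :
    ∃ f : S, IsIdempotentElem f ∧ ρ s (f * t) := by
  obtain ⟨a, ⟨e, he, hae⟩, b, ⟨g, hg, hbg⟩, ha, hb, f, hf, hle⟩ := h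
  have ha' : a⁻¹ * a = e := by
    have h1 := hρ.mul_compat (hρ.inv_rel_inv hae) hae
    rw [inv_eq_self he, he.eq] at h1
    exact hsep _ _ (isIdempotentElem_inv_mul a) he h1
  have hb' : b * b⁻¹ = g := by
    have h1 := hρ.mul_compat hbg (hρ.inv_rel_inv hbg)
    rw [inv_eq_self hg, hg.eq] at h1
    exact hsep _ _ (isIdempotentElem_mul_inv b) hg h1
  have hasb := hρ.mul_compat (hρ.mul_right s hae) hbg
  rw [hle, ← ha', ha, ← hb', ← hb, InverseSemigroup.mul_inv_mul, ← mul_assoc,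
    InverseSemigroup.mul_inv_mul] at hasb
  exact ⟨f, hf, hρ.symm hasb⟩

theorem rel_of_rel_mul_of_rel_mul (hρ : IsCongruence ρ) {s t f g : S}
    (hf : IsIdempotentElem f) (hg : IsIdempotentElem g)
    (hst : ρ s (f * t)) (hts : ρ t (g * s)) : ρ s t := by
  have hfs : ρ (f * s) s := by
    have h := hρ.mul_left f hst
    rw [← mul_assoc, hf.eq] at h
    exact hρ.trans h (hρ.symm hst)
  have h := hρ.mul_left f hts
  rw [← mul_assoc, mul_comm_of_isIdempotentElem hf hg, mul_assoc] at h
  exact hρ.trans hst (hρ.trans h (hρ.trans (hρ.mul_left g hfs) (hρ.symm hts)))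

end IsCongruence

/-- If `ρ` is an idempotent-separating congruence on `S` with kernel `K`,
then `ρ` and `≃_K` are equal. -/
theorem idempotent_separating_cong_eq_simeqN {S : Type*} [InverseSemigroup S]
    (ρ : S → S → Prop) (hρ : IsCongruence ρ)
    (hsep : ∀ e f : S, IsIdempotentElem e → IsIdempotentElem f → ρ e f → e = f) :
    ∀ s t : S, ρ s t ↔ SimeqN {u : S | ∃ e : S, IsIdempotentElem e ∧ ρ u e} s t := by
  intro s t
  constructor
  · exact fun h => ⟨hρ.leN_kernel_of_rel hsep h, hρ.leN_kernel_of_rel hsep (hρ.symm h)⟩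
  · rintro ⟨hst, hts⟩
    obtain ⟨f, hf, hsf⟩ := hρ.exists_rel_mul_of_leN_kernel hsep hst
    obtain ⟨g, hg, htg⟩ := hρ.exists_rel_mul_of_leN_kernel hsep hts
    exact hρ.rel_of_rel_mul_of_rel_mul hf hg hsf htg
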